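/- arXiv:1109.4675 — 2 statements merged into one kernel-verified Lean document; each statement's English description precedes it below -/
import Mathlib

section
/- Let G be a 2-connected graph on n vertices containing no induced subgraph isomorphic to K_{1,3} (claw-free). Then every longest cycle of G contains all vertices of degree at least n/2. -/
open SimpleGraph

/-- A graph is 2-connected if it has at least 3 vertices and deleting any vertex
leaves a connected graph. -/
def TwoConnected {V : Type*} [Fintype V] (G : SimpleGraph V) : Prop :=
  3 ≤ Fintype.card V ∧ ∀ v : V, (G.induce {u | u ≠ v}).Connected

namespace SimpleGraph

variable {V : Type*} {G : SimpleGraph V}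

theorem exists_isCycle_of_isChain {a : V} {l : List V} (hnd : (a :: l).Nodup)
    (hc : (a :: l ++ [a]).IsChain G.Adj) (hl : 2 ≤ l.length) :
    ∃ (b : V) (C : G.Walk b b), C.IsCycle ∧ C.length = l.length + 1 := by
  have hne : a :: l ++ [a] ≠ [] := by simp
  obtain ⟨b, p, rfl, hp⟩ : ∃ (b : V) (p : G.Walk a b), a = b ∧ p.support = a :: l ++ [a] :=
    ⟨_, Walk.ofSupport _ hne hc, by simp, Walk.support_ofSupport hne hc⟩
  have hlen : p.length = l.length + 1 := by
    have := p.length_support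
    simp [hp] at this
    omega
  refine ⟨a, p, Walk.isCycle_iff_isPath_tail_and_le_length.2 ⟨?_, by omega⟩, hlen⟩
  rw [Walk.isPath_def, Walk.support_tail_of_not_nil, hp]
  · exact (List.perm_append_singleton a l).nodup_iff.2 hnd
  · rw [Walk.not_nil_iff_lt_length]; omega

theorem isChain_append_of_closed {l₁ l₂ : List V} {v : V} (hnd : (l₁ ++ v :: l₂).Nodup)
    (hc : (l₁ ++ v :: l₂).IsChain G.Adj)
    (hcl : ∀ a ∈ (l₁ ++ v :: l₂).head?, ∀ b ∈ (l₁ ++ v :: l₂).getLast?, a = b ∨ G.Adj b a) :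
    (v :: l₂ ++ l₁).IsChain G.Adj := by
  cases l₁ with
  | nil => simpa using hc
  | cons a l =>
    rw [List.isChain_append] at hc ⊢
    refine ⟨hc.2.1, hc.1, fun b hb a' ha' => ?_⟩
    have hbmem : b ∈ v :: l₂ := List.mem_of_getLast? hb
    have hab : a' = a := by simpa using ha'.symm
    subst hab
    refine (hcl a' (by simp) b (by rw [List.getLast?_append, hb]; rfl)).resolve_left ?_
    rintro rfl
    exact List.disjoint_of_nodup_append hnd (by simp) hbmem

/-- A finite vertex set without independent triples either has a Hamiltonian path
or splits into two nonempty cliques with no edges between them. -/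
theorem exists_hamiltonian_list_or_cliques (S : Finset V)
    (hS : ∀ a ∈ S, ∀ b ∈ S, ∀ c ∈ S, a ≠ b → a ≠ c → b ≠ c →
      G.Adj a b ∨ G.Adj a c ∨ G.Adj b c) :
    (∃ l : List V, l.Nodup ∧ l.IsChain G.Adj ∧ ∀ v, v ∈ l ↔ v ∈ S) ∨
    ∃ A B : Finset V, A.Nonempty ∧ B.Nonempty ∧ (∀ v, v ∈ S ↔ v ∈ A ∨ v ∈ B) ∧
      (∀ a ∈ A, ∀ b ∈ B, a ≠ b ∧ ¬ G.Adj a b) ∧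
      (∀ a ∈ A, ∀ b ∈ A, a ≠ b → G.Adj a b) ∧
      (∀ a ∈ B, ∀ b ∈ B, a ≠ b → G.Adj a b) := by
  classical
  let P : ℕ → Prop := fun n => ∃ l : List V, l.Nodup ∧ l.IsChain G.Adj ∧ (∀ v ∈ l, v ∈ S) ∧
    l.length = n
  have hP0 : P 0 := ⟨[], by simp, by simp, by simp, rfl⟩
  have hbound : ∀ n, P n → n ≤ S.card := by
    rintro n ⟨l, hnd, -, hl, rfl⟩
    rw [← List.toFinset_card_of_nodup hnd]
    exact Finset.card_le_card fun v hv => hl v (List.mem_toFinset.1 hv)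
  obtain ⟨l, hnd, hc, hlS, hlen⟩ := Nat.findGreatest_spec (P := P) (Nat.zero_le S.card) hP0
  have hmax : ∀ l' : List V, l'.Nodup → l'.IsChain G.Adj → (∀ v ∈ l', v ∈ S) →
      l'.length ≤ l.length := fun l' h₁ h₂ h₃ =>
    hlen ▸ Nat.le_findGreatest (hbound _ ⟨l', h₁, h₂, h₃, rfl⟩) ⟨l', h₁, h₂, h₃, rfl⟩
  by_cases hall : ∀ v ∈ S, v ∈ l
  · exact .inl ⟨l, hnd, hc, fun v => ⟨hlS v, hall v⟩⟩
  right
  push Not at hall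
  obtain ⟨z₀, hz₀S, hz₀⟩ := hall
  have hhead : ∀ z ∈ S, z ∉ l → ∀ a ∈ l.head?, ¬ G.Adj z a := by
    intro z hzS hz a ha hadj
    have := hmax (z :: l) (List.nodup_cons.2 ⟨hz, hnd⟩)
      (List.isChain_cons.2 ⟨fun y hy => by
        rw [Option.mem_def] at ha hy; rw [ha] at hy; simpa [← Option.some.inj hy], hc⟩)
      (by simpa [hzS] using hlS)
    simp at this
  have hlast : ∀ z ∈ S, z ∉ l → ∀ b ∈ l.getLast?, ¬ G.Adj b z := by
    intro z hzS hz b hb hadj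
    have := hmax (l ++ [z]) (by simp [List.nodup_append, hnd]; rintro a ha rfl; exact hz ha)
      (List.isChain_append.2 ⟨hc, by simp, fun y hy => by
        rw [Option.mem_def] at hb hy; rw [hb] at hy; simpa [← Option.some.inj hy]⟩)
      (by simp; rintro v (hv | rfl); exacts [hlS v hv, hzS])
    simp at this
  have hclosed : ∀ a ∈ l.head?, ∀ b ∈ l.getLast?, a = b ∨ G.Adj b a := by
    intro a ha b hb
    by_contra! h
    have hal := List.mem_of_head? ha
    have hbl := List.mem_of_getLast? hb
    rcases hS a (hlS a hal) b (hlS b hbl) z₀ hz₀S h.1 (by rintro rfl; exact hz₀ hal)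
      (by rintro rfl; exact hz₀ hbl) with h' | h' | h'
    · exact h.2 h'.symm
    · exact hhead z₀ hz₀S hz₀ a ha h'.symm
    · exact hlast z₀ hz₀S hz₀ b hb h'
  have hnon : ∀ z ∈ S, z ∉ l → ∀ v ∈ l, ¬ G.Adj z v := by
    intro z hzS hz v hv hadj
    obtain ⟨l₁, l₂, rfl⟩ := List.append_of_mem hv
    have hrot := isChain_append_of_closed hnd hc hclosed
    have hperm : (v :: l₂ ++ l₁).Perm (l₁ ++ v :: l₂) := List.perm_append_comm
    have := hmax (z :: (v :: l₂ ++ l₁))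
      (List.nodup_cons.2 ⟨fun h => hz (hperm.mem_iff.1 h), hperm.nodup_iff.2 hnd⟩)
      (List.IsChain.cons_cons hadj hrot)
      (by
        intro w hw
        rcases List.mem_cons.1 hw with rfl | hw
        · exact hzS
        · exact hlS w (hperm.mem_iff.1 hw))
    simp at this
    omega
  have hne : l ≠ [] := by
    rintro rfl
    have := hmax [z₀] (by simp) (by simp) (by simpa using hz₀S)
    simp at this
  obtain ⟨a₀, ha₀⟩ := List.exists_mem_of_ne_nil l hne
  refine ⟨l.toFinset, S.filter (· ∉ l), ⟨a₀, by simpa using ha₀⟩, ⟨z₀, by simp [hz₀S, hz₀]⟩,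
    ?_, ?_, ?_, ?_⟩
  · intro v
    have := hlS v
    simp only [List.mem_toFinset, Finset.mem_filter]
    tauto
  · simp only [List.mem_toFinset, Finset.mem_filter]
    rintro a ha b ⟨hbS, hb⟩
    exact ⟨by rintro rfl; exact hb ha, fun h => hnon b hbS hb a ha h.symm⟩
  · simp only [List.mem_toFinset]
    intro a ha b hb hab
    rcases hS a (hlS a ha) b (hlS b hb) z₀ hz₀S hab (by rintro rfl; exact hz₀ ha)
      (by rintro rfl; exact hz₀ hb) with h | h | h
    · exact h
    · exact (hnon z₀ hz₀S hz₀ a ha h.symm).elim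
    · exact (hnon z₀ hz₀S hz₀ b hb h.symm).elim
  · simp only [Finset.mem_filter]
    rintro a ⟨haS, ha⟩ b ⟨hbS, hb⟩ hab
    rcases hS a haS b hbS a₀ (hlS a₀ ha₀) hab (by rintro rfl; exact ha ha₀)
      (by rintro rfl; exact hb ha₀) with h | h | h
    · exact h
    · exact (hnon a haS ha a₀ ha₀ h).elim
    · exact (hnon b hbS hb a₀ ha₀ h).elim

/-- A clique can be listed as a path starting at any of its vertices. -/
theorem exists_list_of_clique {K : Finset V}
    (hK : ∀ a ∈ K, ∀ b ∈ K, a ≠ b → G.Adj a b) {a : V} (ha : a ∈ K) :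
    ∃ l : List V, (a :: l).Nodup ∧ (a :: l).IsChain G.Adj ∧ ∀ v, v ∈ a :: l ↔ v ∈ K := by
  classical
  have hnd : (a :: (K.erase a).toList).Nodup := by simp [Finset.nodup_toList]
  have hmem : ∀ v, v ∈ a :: (K.erase a).toList ↔ v ∈ K := by
    intro v
    by_cases h : v = a <;> simp [h, ha]
  refine ⟨(K.erase a).toList, hnd, List.Pairwise.isChain ?_, hmem⟩
  exact hnd.imp_of_mem fun hu hv huv => hK _ ((hmem _).1 hu) _ ((hmem _).1 hv) huv

/-- In a 2-connected graph, two disjoint sets are joined by a path that avoids a given vertex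
and meets the sets only at its ends. -/
theorem _root_.TwoConnected.exists_isChain [Fintype V] (hG : TwoConnected G) {x : V}
    {S T : Set V} (hST : ∀ v ∈ S, v ∉ T) (hxS : x ∉ S) (hxT : x ∉ T)
    (hS : S.Nonempty) (hT : T.Nonempty) :
    ∃ (s t : V) (m : List V), s ∈ S ∧ t ∈ T ∧ (s :: m ++ [t]).IsChain G.Adj ∧
      m.Nodup ∧ x ∉ m ∧ ∀ v ∈ m, v ∉ S ∧ v ∉ T := by
  classical
  obtain ⟨s₀, hs₀⟩ := hS
  obtain ⟨t₀, ht₀⟩ := hT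
  have hstart : ∃ (s t : V) (m : List V), s ∈ S ∧ t ∈ T ∧ (s :: m ++ [t]).IsChain G.Adj ∧
      m.Nodup ∧ x ∉ m := by
    have hs : s₀ ≠ x := by rintro rfl; exact hxS hs₀
    have ht : t₀ ≠ x := by rintro rfl; exact hxT ht₀
    obtain ⟨p, hp⟩ := ((hG.2 x).preconnected ⟨s₀, hs⟩ ⟨t₀, ht⟩).exists_isPath
    obtain ⟨q, hqp, hqx⟩ : ∃ q : G.Walk s₀ t₀, q.IsPath ∧ x ∉ q.support := by
      refine ⟨p.map (Embedding.induce {u | u ≠ x}).toHom,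
        hp.map Subtype.val_injective, fun h => ?_⟩
      obtain ⟨⟨v, hv⟩, -, hvx⟩ := List.mem_map.1 (Walk.support_map _ p ▸ h)
      exact hv hvx
    have hne : s₀ ≠ t₀ := by rintro rfl; exact hST _ hs₀ ht₀
    have hq' := q.isChain_adj_support
    rw [Walk.isPath_def] at hqp
    cases q with
    | nil => exact (hne rfl).elim
    | cons h r =>
      refine ⟨s₀, t₀, r.support.dropLast, hs₀, ht₀, ?_, ?_, ?_⟩
      · have : r.support.dropLast ++ [t₀] = r.support := by
          simp
        rw [List.cons_append, this]
        simpa using hq'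
      · exact (List.nodup_cons.1 hqp).2.sublist (List.dropLast_sublist _)
      · intro hx
        exact hqx (List.mem_cons_of_mem _ (List.dropLast_subset _ hx))
  obtain ⟨s, t, m, h⟩ := hstart
  induction hn : m.length using Nat.strong_induction_on generalizing s t m with
  | _ n ih =>
    obtain ⟨hs, ht, hc, hnd, hx⟩ := h
    by_cases hall : ∀ v ∈ m, v ∉ S ∧ v ∉ T
    · exact ⟨s, t, m, hs, ht, hc, hnd, hx, hall⟩
    push Not at hall
    obtain ⟨v, hv, hvST⟩ := hall
    obtain ⟨m₁, m₂, rfl⟩ := List.append_of_mem hv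
    have hc' : (s :: m₁ ++ [v]).IsChain G.Adj ∧ (v :: m₂ ++ [t]).IsChain G.Adj := by
      have : s :: (m₁ ++ v :: m₂) ++ [t] = (s :: m₁) ++ v :: (m₂ ++ [t]) := by simp
      rw [this, List.isChain_split] at hc
      exact hc
    by_cases hvS : v ∈ S
    · exact ih m₂.length (by simp at hn; omega) v t m₂
        ⟨hvS, ht, hc'.2, (List.nodup_cons.1 hnd.of_append_right).2, by simp at hx; tauto⟩ rfl
    · exact ih m₁.length (by simp at hn; omega) s v m₁
        ⟨hs, hvST hvS, hc'.1, hnd.of_append_left, by simp at hx; tauto⟩ rfl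

/-- `f` runs periodically, with period `c`, through the vertices of a cycle of length `c`. -/
structure IsCyclicEnum (G : SimpleGraph V) (f : ℕ → V) (c : ℕ) : Prop where
  adj : ∀ i, G.Adj (f i) (f (i + 1))
  periodic : ∀ i, f (i + c) = f i
  ne : ∀ i j, i < j → j < i + c → f i ≠ f j

theorem Walk.IsCycle.isCyclicEnum {a : V} {C : G.Walk a a} (hC : C.IsCycle) :
    G.IsCyclicEnum (fun i => C.getVert (i % C.length)) C.length := by
  have h3 := hC.three_le_length
  refine ⟨fun i => ?_, fun i => by simp, fun i j hij hji h => ?_⟩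
  · have hlt : i % C.length < C.length := Nat.mod_lt _ (by omega)
    have hadj := C.adj_getVert_succ hlt
    rcases Nat.lt_or_ge (i % C.length + 1) C.length with h | h
    · rwa [← Nat.mod_eq_of_lt h, Nat.mod_add_mod] at hadj
    · have h' : i % C.length + 1 = C.length := by omega
      have h0 : (i + 1) % C.length = 0 := by rw [← Nat.mod_add_mod, h', Nat.mod_self]
      rw [h', Walk.getVert_length] at hadj
      simpa only [h0, Walk.getVert_zero] using hadj
  · have hi := Nat.mod_lt i (show 0 < C.length by omega)
    have hj := Nat.mod_lt j (show 0 < C.length by omega)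
    have hmod : i % C.length = j % C.length :=
      hC.getVert_injOn' (by simp only [Set.mem_ofPred_eq]; omega)
        (by simp only [Set.mem_ofPred_eq]; omega) h
    have hdvd := (Nat.modEq_iff_dvd' hij.le).1 hmod
    have := Nat.le_of_dvd (by omega) hdvd
    omega

namespace IsCyclicEnum

variable {f : ℕ → V} {c : ℕ}

theorem exists_mem_Ico (hf : G.IsCyclicEnum f c) (hc : 0 < c) (i m : ℕ) :
    ∃ m' ∈ Finset.Ico i (i + c), f m' = f m := by
  induction i with
  | zero => exact ⟨m % c, by simp [Nat.mod_lt _ hc], Function.Periodic.map_mod_nat hf.periodic m⟩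
  | succ i ih =>
    obtain ⟨m', hm', hfm⟩ := ih
    rw [Finset.mem_Ico] at hm'
    rcases hm'.1.eq_or_lt with rfl | h
    · exact ⟨i + c, by simp; omega, by rw [hf.periodic, hfm]⟩
    · exact ⟨m', by simp; omega, hfm⟩

/-- In a longest cycle, a path outside the cycle is shorter than the arcs it could replace. -/
theorem length_lt_of_isChain (hf : G.IsCyclicEnum f c)
    (hmax : ∀ (a : V) (l : List V), (a :: l).Nodup → (a :: l ++ [a]).IsChain G.Adj →
      2 ≤ l.length → l.length + 1 ≤ c)
    {i j : ℕ} (hij : i < j) (hji : j < i + c) {L : List V} (hL : L ≠ []) (hnd : L.Nodup)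
    (hdisj : ∀ v ∈ L, v ∉ Set.range f) (hch : (f i :: L ++ [f j]).IsChain G.Adj) :
    i + L.length < j := by
  have hpos := List.length_pos_of_ne_nil hL
  obtain ⟨k, hk⟩ : ∃ k, i + c = j + k + 1 := ⟨i + c - j - 1, by omega⟩
  have := hmax (f i) (L ++ (List.range' j (k + 1)).map f) ?_ ?_ ?_
  · simp at this; omega
  · rw [List.nodup_cons, List.nodup_append]
    refine ⟨?_, hnd, ?_, ?_⟩
    · rw [List.mem_append, List.mem_map]
      rintro (h | ⟨m, hm, h⟩)
      · exact hdisj _ h ⟨i, rfl⟩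
      · rw [List.mem_range'_1] at hm
        exact hf.ne i m (by omega) (by omega) h.symm
    · refine List.Nodup.map_on (fun m hm m' hm' h => ?_) List.nodup_range'
      rw [List.mem_range'_1] at hm hm'
      by_contra hne
      rcases Nat.lt_or_gt_of_ne hne with h' | h'
      · exact hf.ne m m' h' (by omega) h
      · exact hf.ne m' m h' (by omega) h.symm
    · rintro v hv w hw rfl
      obtain ⟨m, -, h⟩ := List.mem_map.1 hw
      exact hdisj v hv ⟨m, h⟩
  · have h₁ : ((List.range' j (k + 2)).map f).IsChain G.Adj := by
      rw [List.isChain_map]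
      exact (List.isChain_range' j (k + 2) 1).imp fun a b (h : b = a + 1) => h ▸ hf.adj a
    have h₂ : (List.range' j (k + 2)).map f =
        f j :: ((List.range' (j + 1) k).map f ++ [f i]) := by
      rw [← hf.periodic i, hk, List.range'_succ, List.range'_concat]
      simp [add_comm, add_left_comm, add_assoc]
    have h₃ : f i :: (L ++ (List.range' j (k + 1)).map f) ++ [f i] =
        (f i :: L) ++ f j :: ((List.range' (j + 1) k).map f ++ [f i]) := by
      simp [List.range'_succ]
    rw [h₃, List.isChain_split]
    exact ⟨hch, h₂ ▸ h₁⟩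
  · simp; omega

end IsCyclicEnum

/-- `L` is the interior of a path from `p` to `q` that runs outside `s` and covers `x`
together with all neighbours of `x` outside `s`. -/
structure IsDetour (G : SimpleGraph V) (s : Set V) (x p q : V) (L : List V) : Prop where
  nodup : L.Nodup
  disjoint : ∀ v ∈ L, v ∉ s
  isChain : (p :: L ++ [q]).IsChain G.Adj
  mem : x ∈ L
  nbrs : ∀ y, G.Adj x y → y ∉ s → y ∈ L

/-- The neighbours of `x` in `s` are covered by two disjoint nonempty parts of `s`
such that any vertex of the one and any vertex of the other are joined by a detour. -/
def HasDetours (G : SimpleGraph V) (s : Set V) (x : V) : Prop :=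
  ∃ A B : Set V, A.Nonempty ∧ B.Nonempty ∧ A ⊆ s ∧ B ⊆ s ∧ (∀ v ∈ A, v ∉ B) ∧
    (∀ u ∈ s, G.Adj x u → u ∈ A ∨ u ∈ B) ∧ ∀ p ∈ A, ∀ q ∈ B, ∃ L, G.IsDetour s x p q L

section Counting

variable [Fintype V] [DecidableRel G.Adj] {f : ℕ → V} {c : ℕ} {x : V}

open Classical in
theorem IsCyclicEnum.card_add_card_lt (hf : G.IsCyclicEnum f c) (hx : x ∉ Set.range f) :
    c + ((G.neighborFinset x).filter (· ∉ Set.range f)).card + 1 ≤ Fintype.card V := by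
  set Y := (G.neighborFinset x).filter (· ∉ Set.range f)
  have hcard : ((Finset.range c).image f).card = c := by
    rw [Finset.card_image_of_injOn, Finset.card_range]
    intro m hm m' hm' h
    simp only [Finset.coe_range, Set.mem_Iio] at hm hm'
    by_contra hne
    rcases Nat.lt_or_gt_of_ne hne with h' | h'
    · exact hf.ne m m' h' (by omega) h
    · exact hf.ne m' m h' (by omega) h.symm
  have hd₁ : Disjoint ((Finset.range c).image f) Y := by
    rw [Finset.disjoint_left]
    rintro v hv hvY
    obtain ⟨m, -, rfl⟩ := Finset.mem_image.1 hv
    exact (Finset.mem_filter.1 hvY).2 ⟨m, rfl⟩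
  have hx' : x ∉ (Finset.range c).image f ∪ Y := by
    rw [Finset.mem_union, Finset.mem_image]
    rintro (⟨m, -, h⟩ | h)
    · exact hx ⟨m, h⟩
    · simp [Y] at h
  have := Finset.card_le_univ (insert x ((Finset.range c).image f ∪ Y))
  rwa [Finset.card_insert_of_notMem hx', Finset.card_union_of_disjoint hd₁, hcard] at this

open Classical in
theorem card_neighborFinset_filter (s : Set V) :
    ((G.neighborFinset x).filter (· ∈ s)).card + ((G.neighborFinset x).filter (· ∉ s)).card =
      G.degree x := by
  rw [Finset.card_filter_add_card_filter_not, card_neighborFinset_eq_degree]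

theorem IsCyclicEnum.degree_lt_of_isDetour (hf : G.IsCyclicEnum f c) (hc : 3 ≤ c)
    (hmax : ∀ (a : V) (l : List V), (a :: l).Nodup → (a :: l ++ [a]).IsChain G.Adj →
      2 ≤ l.length → l.length + 1 ≤ c)
    (hx : x ∉ Set.range f) {i j : ℕ} (hij : i < j) (hji : j < i + c)
    (hgap : ∀ m, i < m → m < j → ¬ G.Adj x (f m)) {L : List V}
    (hL : G.IsDetour (Set.range f) x (f i) (f j) L) :
    2 * G.degree x < Fintype.card V := by
  classical
  set U := (G.neighborFinset x).filter (· ∈ Set.range f)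
  set Y := (G.neighborFinset x).filter (· ∉ Set.range f) with hY
  have hYL : Y.card + 1 ≤ L.length := by
    rw [← Finset.card_insert_of_notMem (show x ∉ Y by simp [Y]),
      ← List.toFinset_card_of_nodup hL.nodup]
    refine Finset.card_le_card fun v hv => List.mem_toFinset.2 ?_
    rcases Finset.mem_insert.1 hv with rfl | hv
    · exact hL.mem
    · simp only [hY, Finset.mem_filter, mem_neighborFinset] at hv
      exact hL.nbrs v hv.1 hv.2
  have harc := hf.length_lt_of_isChain hmax hij hji (List.ne_nil_of_mem hL.mem) hL.nodup
    hL.disjoint hL.isChain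
  have hsep : ∀ m, G.Adj x (f m) → ¬ G.Adj x (f (m + 1)) := by
    intro m h₁ h₂
    have := hf.length_lt_of_isChain hmax (i := m) (j := m + 1) (L := [x]) (by omega) (by omega)
      (by simp) (by simp) (by simpa using hx) (by simp [h₁.symm, h₂])
    simp at this
  let W := (Finset.Ico i (i + c)).filter fun m => G.Adj x (f m)
  let W' := (Finset.Ico i (i + c)).filter fun m => G.Adj x (f (m + 1))
  let I := Finset.Ico (i + 1) (j - 1)
  have hW : U.card ≤ W.card := by
    refine (Finset.card_le_card fun u hu => ?_).trans (Finset.card_image_le (f := f))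
    simp only [U, Finset.mem_filter, mem_neighborFinset] at hu
    obtain ⟨hxu, m, rfl⟩ := hu
    obtain ⟨m', hm', h⟩ := hf.exists_mem_Ico (by omega) i m
    exact Finset.mem_image.2 ⟨m', Finset.mem_filter.2 ⟨hm', h ▸ hxu⟩, h⟩
  have hW' : U.card ≤ W'.card := by
    refine (Finset.card_le_card fun u hu => ?_).trans
      (Finset.card_image_le (f := fun m => f (m + 1)))
    simp only [U, Finset.mem_filter, mem_neighborFinset] at hu
    obtain ⟨hxu, m, rfl⟩ := hu
    obtain ⟨m', hm', h⟩ := hf.exists_mem_Ico (by omega) (i + 1) m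
    rw [Finset.mem_Ico] at hm'
    obtain ⟨m'', rfl⟩ : ∃ m'', m' = m'' + 1 := ⟨m' - 1, by omega⟩
    exact Finset.mem_image.2
      ⟨m'', Finset.mem_filter.2 ⟨Finset.mem_Ico.2 (by omega), h ▸ hxu⟩, h⟩
  have hWW' : Disjoint W W' := by
    rw [Finset.disjoint_left]
    intro m hm hm'
    exact hsep m (Finset.mem_filter.1 hm).2 (Finset.mem_filter.1 hm').2
  have hI : Disjoint (W ∪ W') I := by
    rw [Finset.disjoint_right]
    intro m hm hmW
    rw [Finset.mem_Ico] at hm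
    rcases Finset.mem_union.1 hmW with h | h
    · exact hgap m (by omega) (by omega) (Finset.mem_filter.1 h).2
    · exact hgap (m + 1) (by omega) (by omega) (Finset.mem_filter.1 h).2
  have hsub : W ∪ W' ∪ I ⊆ Finset.Ico i (i + c) := by
    refine Finset.union_subset (Finset.union_subset (Finset.filter_subset _ _)
      (Finset.filter_subset _ _)) fun m hm => ?_
    rw [Finset.mem_Ico] at hm ⊢
    omega
  have hcount := Finset.card_le_card hsub
  rw [Finset.card_union_of_disjoint hI, Finset.card_union_of_disjoint hWW', Nat.card_Ico,
    Nat.card_Ico] at hcount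
  have h₁ := hf.card_add_card_lt hx
  have h₂ : U.card + Y.card = G.degree x := card_neighborFinset_filter _
  change c + Y.card + 1 ≤ _ at h₁
  omega

theorem IsCyclicEnum.degree_lt_of_hasDetours (hf : G.IsCyclicEnum f c) (hc : 3 ≤ c)
    (hmax : ∀ (a : V) (l : List V), (a :: l).Nodup → (a :: l ++ [a]).IsChain G.Adj →
      2 ≤ l.length → l.length + 1 ≤ c)
    (hx : x ∉ Set.range f) (h : G.HasDetours (Set.range f) x) :
    2 * G.degree x < Fintype.card V := by
  classical
  obtain ⟨A, B, ⟨p, hp⟩, ⟨q, hq⟩, hA, hB, hAB, hU, hL⟩ := h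
  obtain ⟨i, rfl⟩ := hA hp
  have hj : ∃ j, i < j ∧ f j ∈ B := by
    obtain ⟨j, rfl⟩ := hB hq
    obtain ⟨j', hj', h⟩ := hf.exists_mem_Ico (by omega) i j
    refine ⟨j', lt_of_le_of_ne (Finset.mem_Ico.1 hj').1 ?_, h ▸ hq⟩
    rintro rfl
    exact hAB _ hp (h ▸ hq)
  obtain ⟨hij, hjB⟩ := Nat.find_spec hj
  have hmin : ∀ m, i < m → f m ∈ B → Nat.find hj ≤ m := fun m h₁ h₂ => Nat.find_min' hj ⟨h₁, h₂⟩
  set j := Nat.find hj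
  have hji : j < i + c := by
    obtain ⟨m, hm, h⟩ := hf.exists_mem_Ico (by omega) (i + 1) j
    rw [Finset.mem_Ico] at hm
    have := hmin m (by omega) (h ▸ hjB)
    rcases eq_or_ne m (i + c) with rfl | hne
    · rw [hf.periodic] at h
      exact (hAB _ hp (h ▸ hjB)).elim
    · omega
  have hi₁ : i ≤ Nat.findGreatest (fun m => f m ∈ A) (j - 1) :=
    Nat.le_findGreatest (by omega) hp
  have hi₂ : f (Nat.findGreatest (fun m => f m ∈ A) (j - 1)) ∈ A :=
    Nat.findGreatest_spec (P := fun m => f m ∈ A) (show i ≤ j - 1 by omega) hp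
  have hi₃ := Nat.findGreatest_le (P := fun m => f m ∈ A) (j - 1)
  have hi₄ : ∀ m, Nat.findGreatest (fun m => f m ∈ A) (j - 1) < m → m ≤ j - 1 → f m ∉ A :=
    fun m h₁ h₂ => Nat.findGreatest_is_greatest h₁ h₂
  generalize Nat.findGreatest (fun m => f m ∈ A) (j - 1) = i' at hi₁ hi₂ hi₃ hi₄
  obtain ⟨L, hL⟩ := hL _ hi₂ _ hjB
  refine hf.degree_lt_of_isDetour hc hmax hx (i := i') (j := j) (by omega) (by omega) ?_ hL
  intro m h₁ h₂ hadj
  rcases hU _ ⟨m, rfl⟩ hadj with h | h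
  · exact hi₄ m h₁ (by omega) h
  · have := hmin m (by omega) h
    omega

end Counting

section Detours

theorem isChain_append_singleton_of_forall {l : List V} {x : V} (hl : l.IsChain G.Adj)
    (h : ∀ a ∈ l, G.Adj a x) : (l ++ [x]).IsChain G.Adj :=
  List.isChain_append.2 ⟨hl, by simp, fun a ha b hb => by
    obtain rfl : x = b := by simpa using hb
    exact h a (List.mem_of_getLast? ha)⟩

theorem isChain_cons_of_forall {l : List V} {x : V} (hl : l.IsChain G.Adj)
    (h : ∀ a ∈ l, G.Adj x a) : (x :: l).IsChain G.Adj :=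
  List.isChain_cons.2 ⟨fun a ha => h a (List.mem_of_head? ha), hl⟩

theorem isChain_adj_reverse {l : List V} : l.reverse.IsChain G.Adj ↔ l.IsChain G.Adj := by
  rw [List.isChain_reverse]
  simp only [G.adj_comm]

variable {s : Set V} {x : V}

theorem hasDetours_of_forall {w : V} (hw : w ∈ s) (htwo : ∃ u ∈ s, G.Adj x u ∧ u ≠ w)
    (h : ∀ u ∈ s, G.Adj x u → u ≠ w → ∃ L, G.IsDetour s x w u L) : G.HasDetours s x := by
  obtain ⟨u, hu, hxu, huw⟩ := htwo
  refine ⟨{w}, {u | u ∈ s ∧ G.Adj x u ∧ u ≠ w}, ⟨w, rfl⟩, ⟨u, hu, hxu, huw⟩, by simpa using hw,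
    fun v hv => hv.1, by simp, fun v hv hxv => ?_, ?_⟩
  · by_cases hvw : v = w
    · exact .inl hvw
    · exact .inr ⟨hv, hxv, hvw⟩
  · rintro p rfl q ⟨hq, hxq, hqp⟩
    exact h q hq hxq hqp

variable [Fintype V]

theorem hasDetours_of_hamiltonian_list (hG : TwoConnected G)
    (hfree : ∀ x a b c, G.Adj x a → G.Adj x b → G.Adj x c → a ≠ b → a ≠ c → b ≠ c →
      G.Adj a b ∨ G.Adj a c ∨ G.Adj b c)
    (hx : x ∉ s) {u₁ u₂ : V} (hu₁ : u₁ ∈ s) (hu₂ : u₂ ∈ s) (hxu₁ : G.Adj x u₁)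
    (hxu₂ : G.Adj x u₂) (hne : u₁ ≠ u₂) {l : List V} (hnd : l.Nodup)
    (hch : l.IsChain G.Adj) (hl : ∀ v, v ∈ l ↔ G.Adj x v ∧ v ∉ s) : G.HasDetours s x := by
  have htwo : ∀ w, ∃ u ∈ s, G.Adj x u ∧ u ≠ w := by
    intro w
    by_cases h : u₁ = w
    · exact ⟨u₂, hu₂, hxu₂, fun h' => hne (h.trans h'.symm)⟩
    · exact ⟨u₁, hu₁, hxu₁, h⟩
  have hxl : x ∉ l := fun h => G.irrefl ((hl x).1 h).1
  by_cases hclosed : ∀ a ∈ l.head?, ∀ b ∈ l.getLast?, a = b ∨ G.Adj b a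
  · rcases l.eq_nil_or_concat with rfl | ⟨l', y', rfl⟩
    · refine hasDetours_of_forall hu₁ (htwo _) fun u hu hxu huw => ⟨[x], by simp, by simpa using hx,
        by simp [hxu₁.symm, hxu], by simp, fun y h₁ h₂ => ?_⟩
      simpa using (hl y).2 ⟨h₁, h₂⟩
    obtain ⟨y, w, m, hy, hw, hmch, hmnd, hxm, hm⟩ := hG.exists_isChain (x := x)
      (S := {v | v ∈ l'.concat y'}) (T := s) (fun v hv => ((hl v).1 hv).2) hxl hx
      ⟨y', by simp⟩ ⟨u₁, hu₁⟩
    generalize l'.concat y' = l at *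
    obtain ⟨l₁, l₂, rfl⟩ := List.append_of_mem (show y ∈ l from hy)
    have hrot := isChain_append_of_closed hnd hch hclosed
    have hperm : (y :: l₂ ++ l₁).Perm (l₁ ++ y :: l₂) := List.perm_append_comm
    rw [List.cons_append] at hrot hperm
    generalize l₂ ++ l₁ = r at hrot hperm
    replace hnd := hperm.nodup_iff.2 hnd
    simp only [← hperm.mem_iff] at hl hxl
    have hm' : ∀ v ∈ m, v ∉ y :: r ∧ v ∉ s := fun v hv =>
      ⟨fun h => (hm v hv).1 (hperm.mem_iff.1 h), (hm v hv).2⟩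
    refine hasDetours_of_forall hw (htwo _) fun u hu hxu huw =>
      ⟨m.reverse ++ y :: (r ++ [x]), ?_, ?_, ?_, by simp, ?_⟩
    · have h₁ : (y :: r ++ [x]).Nodup := by
        rw [(List.perm_append_singleton x (y :: r)).nodup_iff]
        exact List.nodup_cons.2 ⟨hxl, hnd⟩
      refine List.nodup_append.2 ⟨List.nodup_reverse.2 hmnd, h₁, ?_⟩
      rintro a ha b hb rfl
      rw [List.mem_reverse] at ha
      rcases List.mem_append.1 (show a ∈ y :: r ++ [x] from hb) with hb | hb
      · exact (hm' a ha).1 hb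
      · exact hxm (by simpa using (List.mem_singleton.1 hb) ▸ ha)
    · intro v hv
      have : v ∈ m ∨ v ∈ y :: r ∨ v = x := by simpa [or_assoc] using hv
      rcases this with h | h | rfl
      · exact (hm' v h).2
      · exact ((hl v).1 h).2
      · exact hx
    · have h₁ : (w :: m.reverse ++ [y]).IsChain G.Adj := by
        rw [← isChain_adj_reverse]
        simpa using hmch
      have h₂ : (y :: r ++ [x]).IsChain G.Adj :=
        isChain_append_singleton_of_forall hrot fun a ha => ((hl a).1 ha).1.symm
      have h₃ : w :: (m.reverse ++ y :: (r ++ [x])) ++ [u] =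
          (w :: m.reverse) ++ y :: (r ++ x :: [u]) := by simp
      rw [h₃, List.isChain_split]
      refine ⟨h₁, ?_⟩
      rw [← List.cons_append, List.isChain_split]
      exact ⟨h₂, by simpa using hxu⟩
    · intro v h₁ h₂
      have := (hl v).2 ⟨h₁, h₂⟩
      simp at this ⊢
      tauto
  · push Not at hclosed
    obtain ⟨a, ha, b, hb, hab, hnadj⟩ := hclosed
    have hal := (hl a).1 (List.mem_of_head? ha)
    have hbl := (hl b).1 (List.mem_of_getLast? hb)
    have hend : ∃ l' : List V, l'.Perm l ∧ (u₁ :: l').IsChain G.Adj := by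
      rcases hfree x u₁ a b hxu₁ hal.1 hbl.1 (by rintro rfl; exact hal.2 hu₁)
        (by rintro rfl; exact hbl.2 hu₁) hab with h | h | h
      · refine ⟨l, .refl _, List.isChain_cons.2 ⟨fun v hv => ?_, hch⟩⟩
        obtain rfl : a = v := Option.mem_unique ha hv
        exact h
      · refine ⟨l.reverse, List.reverse_perm l,
          List.isChain_cons.2 ⟨fun v hv => ?_, isChain_adj_reverse.2 hch⟩⟩
        rw [List.head?_reverse] at hv
        obtain rfl : b = v := Option.mem_unique hb hv
        exact h
      · exact (hnadj h.symm).elim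
    obtain ⟨l', hperm, hch'⟩ := hend
    refine hasDetours_of_forall hu₁ (htwo _) fun u hu hxu huw =>
      ⟨l' ++ [x], ?_, ?_, ?_, by simp, fun y h₁ h₂ => ?_⟩
    · rw [(List.perm_append_singleton x l').nodup_iff, List.nodup_cons, hperm.nodup_iff,
        hperm.mem_iff]
      exact ⟨hxl, hnd⟩
    · intro v hv
      rcases List.mem_append.1 hv with h | h
      · exact ((hl v).1 (hperm.mem_iff.1 h)).2
      · rwa [List.mem_singleton.1 h]
    · have h₃ : u₁ :: (l' ++ [x]) ++ [u] = (u₁ :: l') ++ x :: [u] := by simp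
      rw [h₃, List.isChain_split]
      refine ⟨isChain_append_singleton_of_forall hch' fun v hv => ?_, by simpa using hxu⟩
      rcases List.mem_cons.1 hv with rfl | hv
      · exact hxu₁.symm
      · exact ((hl v).1 (hperm.mem_iff.1 hv)).1.symm
    · exact List.mem_append_left _ (hperm.mem_iff.2 ((hl y).2 ⟨h₁, h₂⟩))

theorem hasDetours_of_clique_complete (hG : TwoConnected G) (hx : x ∉ s) {u₁ u₂ : V}
    (hu₁ : u₁ ∈ s) (hu₂ : u₂ ∈ s) (hxu₁ : G.Adj x u₁)
    (hxu₂ : G.Adj x u₂) (hne : u₁ ≠ u₂) {K M : Finset V} (hK : K.Nonempty) (hM : M.Nonempty)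
    (hKM : ∀ v, G.Adj x v ∧ v ∉ s ↔ v ∈ K ∨ v ∈ M) (hdisj : ∀ a ∈ K, ∀ b ∈ M, a ≠ b)
    (hKc : ∀ a ∈ K, ∀ b ∈ K, a ≠ b → G.Adj a b) (hMc : ∀ a ∈ M, ∀ b ∈ M, a ≠ b → G.Adj a b)
    (hU : ∀ u ∈ s, G.Adj x u → ∀ a ∈ K, G.Adj u a) : G.HasDetours s x := by
  classical
  have htwo : ∀ w, ∃ u ∈ s, G.Adj x u ∧ u ≠ w := by
    intro w
    by_cases h : u₁ = w
    · exact ⟨u₂, hu₂, hxu₂, fun h' => hne (h.trans h'.symm)⟩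
    · exact ⟨u₁, hu₁, hxu₁, h⟩
  have hKs : ∀ v ∈ K, G.Adj x v ∧ v ∉ s := fun v hv => (hKM v).2 (.inl hv)
  have hMs : ∀ v ∈ M, G.Adj x v ∧ v ∉ s := fun v hv => (hKM v).2 (.inr hv)
  have hxK : x ∉ K := fun h => G.irrefl (hKs x h).1
  have hxM : x ∉ M := fun h => G.irrefl (hMs x h).1
  obtain ⟨b, t, m, hb, ht, hmch, hmnd, hxm, hm⟩ := hG.exists_isChain (x := x)
    (S := {v | v ∈ M}) (T := {v | v ∈ s ∨ v ∈ K})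
    (fun v hv => not_or.2 ⟨(hMs v hv).2, fun h => hdisj v h v hv rfl⟩) hxM (not_or.2 ⟨hx, hxK⟩)
    hM ⟨u₁, .inl hu₁⟩
  have hmM : ∀ v ∈ m, v ∉ M := fun v hv => (hm v hv).1
  have hms : ∀ v ∈ m, v ∉ s := fun v hv => (not_or.1 (hm v hv).2).1
  have hmK : ∀ v ∈ m, v ∉ K := fun v hv => (not_or.1 (hm v hv).2).2
  obtain ⟨lb, hlbnd, hlbch, hlb⟩ := exists_list_of_clique hMc (a := b) hb
  have hmrev : (t :: m.reverse ++ [b]).IsChain G.Adj := by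
    rw [← isChain_adj_reverse]
    simpa using hmch
  have hbx : (b :: lb ++ [x]).IsChain G.Adj :=
    isChain_append_singleton_of_forall hlbch fun v hv => (hMs v ((hlb v).1 hv)).1.symm
  rcases ht with ht | ht
  · obtain ⟨a, ha⟩ := hK
    obtain ⟨la, hland, hlach, hla⟩ := exists_list_of_clique hKc ha
    generalize a :: la = k at hland hlach hla
    refine hasDetours_of_forall ht (htwo _) fun u hu hxu huw =>
      ⟨m.reverse ++ b :: (lb ++ x :: k), ?_, ?_, ?_, by simp, ?_⟩
    · have h₁ : (b :: lb ++ x :: k).Nodup := by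
        refine List.nodup_append.2
          ⟨hlbnd, List.nodup_cons.2 ⟨fun h => hxK ((hla x).1 h), hland⟩, ?_⟩
        rintro v hv v' hv' rfl
        have hvM := (hlb v).1 hv
        rcases List.mem_cons.1 hv' with rfl | h
        · exact hxM hvM
        · exact hdisj v ((hla v).1 h) v hvM rfl
      refine List.nodup_append.2 ⟨List.nodup_reverse.2 hmnd, h₁, ?_⟩
      rintro v hv v' hv' rfl
      rw [List.mem_reverse] at hv
      rcases List.mem_append.1 (show v ∈ b :: lb ++ x :: k from hv') with h | h
      · exact hmM v hv ((hlb v).1 h)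
      · rcases List.mem_cons.1 h with rfl | h
        · exact hxm hv
        · exact hmK v hv ((hla v).1 h)
    · intro v hv
      have : v ∈ m ∨ v ∈ b :: lb ∨ v = x ∨ v ∈ k := by simpa [or_assoc] using hv
      rcases this with h | h | rfl | h
      · exact hms v h
      · exact (hMs v ((hlb v).1 h)).2
      · exact hx
      · exact (hKs v ((hla v).1 h)).2
    · have h₃ : t :: (m.reverse ++ b :: (lb ++ x :: k)) ++ [u] =
          (t :: m.reverse) ++ b :: (lb ++ x :: (k ++ [u])) := by simp
      rw [h₃, List.isChain_split]
      refine ⟨hmrev, ?_⟩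
      rw [← List.cons_append, List.isChain_split]
      refine ⟨hbx, ?_⟩
      rw [← List.cons_append]
      refine isChain_append_singleton_of_forall
        (isChain_cons_of_forall hlach fun v hv => (hKs v ((hla v).1 hv)).1) fun v hv => ?_
      rcases List.mem_cons.1 hv with rfl | hv
      · exact hxu
      · exact (hU u hu hxu v ((hla v).1 hv)).symm
    · intro v h₁ h₂
      have := (hKM v).1 ⟨h₁, h₂⟩
      rw [← hlb, ← hla] at this
      simp at this ⊢
      tauto
  · obtain ⟨lt, hltnd, hltch, hlt⟩ := exists_list_of_clique hKc ht
    refine hasDetours_of_forall hu₁ (htwo _) fun u hu hxu huw =>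
      ⟨lt.reverse ++ t :: (m.reverse ++ b :: (lb ++ [x])), ?_, ?_, ?_, by simp, ?_⟩
    · have h₁ : (b :: lb ++ [x]).Nodup := by
        rw [(List.perm_append_singleton x (b :: lb)).nodup_iff]
        exact List.nodup_cons.2 ⟨fun h => hxM ((hlb x).1 h), hlbnd⟩
      have h₂ : (m.reverse ++ (b :: lb ++ [x])).Nodup := by
        refine List.nodup_append.2 ⟨List.nodup_reverse.2 hmnd, h₁, ?_⟩
        rintro v hv v' hv' rfl
        rw [List.mem_reverse] at hv
        rcases List.mem_append.1 hv' with h | h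
        · exact hmM v hv ((hlb v).1 h)
        · exact hxm (List.mem_singleton.1 h ▸ hv)
      have h₃ : ((t :: lt).reverse ++ (m.reverse ++ (b :: lb ++ [x]))).Nodup := by
        refine List.nodup_append.2 ⟨List.nodup_reverse.2 hltnd, h₂, ?_⟩
        rintro v hv v' hv' rfl
        have hvK := (hlt v).1 (List.mem_reverse.1 hv)
        rcases List.mem_append.1 hv' with h | h
        · exact hmK v (List.mem_reverse.1 h) hvK
        · rcases List.mem_append.1 h with h | h
          · exact hdisj v hvK v ((hlb v).1 h) rfl
          · exact hxK (List.mem_singleton.1 h ▸ hvK)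
      simpa using h₃
    · intro v hv
      have : v ∈ t :: lt ∨ v ∈ m ∨ v ∈ b :: lb ∨ v = x := by
        simp at hv ⊢
        tauto
      rcases this with h | h | h | rfl
      · exact (hKs v ((hlt v).1 h)).2
      · exact hms v h
      · exact (hMs v ((hlb v).1 h)).2
      · exact hx
    · have h₃ : u₁ :: (lt.reverse ++ t :: (m.reverse ++ b :: (lb ++ [x]))) ++ [u] =
          (u₁ :: lt.reverse) ++ t :: (m.reverse ++ b :: (lb ++ x :: [u])) := by simp
      rw [h₃, List.isChain_split]
      constructor
      · rw [← isChain_adj_reverse]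
        have := isChain_append_singleton_of_forall hltch
          (fun v hv => (hU u₁ hu₁ hxu₁ v ((hlt v).1 hv)).symm)
        simpa using this
      rw [← List.cons_append, List.isChain_split]
      refine ⟨hmrev, ?_⟩
      rw [← List.cons_append, List.isChain_split]
      exact ⟨hbx, by simpa using hxu⟩
    · intro v h₁ h₂
      have := (hKM v).1 ⟨h₁, h₂⟩
      rw [← hlb, ← hlt] at this
      simp at this ⊢
      tauto

theorem hasDetours_of_claw_free (hG : TwoConnected G)
    (hfree : ∀ x a b c, G.Adj x a → G.Adj x b → G.Adj x c → a ≠ b → a ≠ c → b ≠ c →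
      G.Adj a b ∨ G.Adj a c ∨ G.Adj b c)
    (hx : x ∉ s) {u₁ u₂ : V} (hu₁ : u₁ ∈ s) (hu₂ : u₂ ∈ s) (hxu₁ : G.Adj x u₁)
    (hxu₂ : G.Adj x u₂) (hne : u₁ ≠ u₂) : G.HasDetours s x := by
  classical
  have hmem : ∀ v, v ∈ (G.neighborFinset x).filter (· ∉ s) ↔ G.Adj x v ∧ v ∉ s := by simp
  rcases exists_hamiltonian_list_or_cliques (G := G) ((G.neighborFinset x).filter (· ∉ s))
    (fun a ha b hb c hc => hfree x a b c ((hmem a).1 ha).1 ((hmem b).1 hb).1 ((hmem c).1 hc).1)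
    with ⟨l, hnd, hch, hl⟩ | ⟨K, M, hK, hM, hKM, hdisj, hKc, hMc⟩
  · simp only [hmem] at hl
    exact hasDetours_of_hamiltonian_list hG hfree hx hu₁ hu₂ hxu₁ hxu₂ hne hnd hch hl
  simp only [hmem] at hKM
  have hKs : ∀ v ∈ K, G.Adj x v ∧ v ∉ s := fun v hv => (hKM v).2 (.inl hv)
  have hMs : ∀ v ∈ M, G.Adj x v ∧ v ∉ s := fun v hv => (hKM v).2 (.inr hv)
  have hor : ∀ u ∈ s, G.Adj x u → (∀ a ∈ K, G.Adj u a) ∨ ∀ b ∈ M, G.Adj u b := by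
    intro u hu hxu
    by_contra! h
    obtain ⟨⟨a, ha, hua⟩, b, hb, hub⟩ := h
    rcases hfree x u a b hxu (hKs a ha).1 (hMs b hb).1 (by rintro rfl; exact (hKs _ ha).2 hu)
      (by rintro rfl; exact (hMs _ hb).2 hu) (hdisj a ha b hb).1 with h | h | h
    · exact hua h
    · exact hub h
    · exact (hdisj a ha b hb).2 h
  by_cases hallK : ∀ u ∈ s, G.Adj x u → ∀ a ∈ K, G.Adj u a
  · exact hasDetours_of_clique_complete hG hx hu₁ hu₂ hxu₁ hxu₂ hne hK hM hKM
      (fun a ha b hb => (hdisj a ha b hb).1) hKc hMc hallK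
  by_cases hallM : ∀ u ∈ s, G.Adj x u → ∀ a ∈ M, G.Adj u a
  · exact hasDetours_of_clique_complete hG hx hu₁ hu₂ hxu₁ hxu₂ hne hM hK
      (fun v => (hKM v).trans or_comm) (fun a ha b hb => (hdisj b hb a ha).1.symm) hMc hKc hallM
  have hA : ∃ u ∈ s, G.Adj x u ∧ ∀ a ∈ K, G.Adj u a := by
    by_contra! h
    refine hallM fun u hu hxu => (hor u hu hxu).resolve_left fun h' => ?_
    obtain ⟨a, ha, hua⟩ := h u hu hxu
    exact hua (h' a ha)
  have hB : ∃ u ∈ s, G.Adj x u ∧ ¬ ∀ a ∈ K, G.Adj u a := by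
    by_contra! h
    exact hallK h
  refine ⟨{u | u ∈ s ∧ G.Adj x u ∧ ∀ a ∈ K, G.Adj u a},
    {u | u ∈ s ∧ G.Adj x u ∧ ¬ ∀ a ∈ K, G.Adj u a}, hA, hB, fun u hu => hu.1, fun u hu => hu.1,
    fun u hu hu' => hu'.2.2 hu.2.2, fun u hu hxu => ?_, ?_⟩
  · by_cases h : ∀ a ∈ K, G.Adj u a
    · exact .inl ⟨hu, hxu, h⟩
    · exact .inr ⟨hu, hxu, h⟩
  rintro p ⟨hp, hxp, hpK⟩ q ⟨hq, hxq, hqK⟩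
  have hqM := (hor q hq hxq).resolve_left hqK
  obtain ⟨a, ha⟩ := hK
  obtain ⟨b, hb⟩ := hM
  obtain ⟨la, hland, hlach, hla⟩ := exists_list_of_clique hKc ha
  obtain ⟨lb, hlbnd, hlbch, hlb⟩ := exists_list_of_clique hMc hb
  generalize a :: la = k at hland hlach hla
  generalize b :: lb = l at hlbnd hlbch hlb
  have hxK : x ∉ K := fun h => G.irrefl (hKs x h).1
  have hxM : x ∉ M := fun h => G.irrefl (hMs x h).1
  refine ⟨k ++ x :: l, ?_, ?_, ?_, by simp, ?_⟩
  · refine List.nodup_append.2 ⟨hland, List.nodup_cons.2 ⟨fun h => hxM ((hlb x).1 h), hlbnd⟩, ?_⟩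
    rintro v hv v' hv' rfl
    have hvK := (hla v).1 hv
    rcases List.mem_cons.1 hv' with rfl | h
    · exact hxK hvK
    · exact (hdisj v hvK v ((hlb v).1 h)).1 rfl
  · intro v hv
    rcases List.mem_append.1 hv with h | h
    · exact (hKs v ((hla v).1 h)).2
    · rcases List.mem_cons.1 h with rfl | h
      · exact hx
      · exact (hMs v ((hlb v).1 h)).2
  · have h₃ : p :: (k ++ x :: l) ++ [q] = (p :: k) ++ x :: (l ++ [q]) := by simp
    rw [h₃, List.isChain_split]
    constructor
    · refine isChain_append_singleton_of_forall
        (isChain_cons_of_forall hlach fun v hv => hpK v ((hla v).1 hv)) fun v hv => ?_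
      rcases List.mem_cons.1 hv with rfl | hv
      · exact hxp.symm
      · exact (hKs v ((hla v).1 hv)).1.symm
    · rw [← List.cons_append]
      refine isChain_append_singleton_of_forall
        (isChain_cons_of_forall hlbch fun v hv => (hMs v ((hlb v).1 hv)).1) fun v hv => ?_
      rcases List.mem_cons.1 hv with rfl | hv
      · exact hxq
      · exact (hqM v ((hlb v).1 hv)).symm
  · intro v h₁ h₂
    have := (hKM v).1 ⟨h₁, h₂⟩
    rw [← hla, ← hlb] at this
    simp
    tauto

/-- In a 2-connected claw-free graph, every closed neighbourhood lies on a cycle. -/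
theorem degree_lt_of_claw_free [DecidableRel G.Adj] (hG : TwoConnected G)
    (hfree : ∀ x a b c, G.Adj x a → G.Adj x b → G.Adj x c → a ≠ b → a ≠ c → b ≠ c →
      G.Adj a b ∨ G.Adj a c ∨ G.Adj b c) {c : ℕ}
    (hmax : ∀ (a : V) (l : List V), (a :: l).Nodup → (a :: l ++ [a]).IsChain G.Adj →
      2 ≤ l.length → l.length + 1 ≤ c) (hdeg : 2 ≤ G.degree x) :
    G.degree x < c := by
  classical
  have hmem : ∀ v, v ∈ G.neighborFinset x ↔ G.Adj x v := by simp
  have key : ∀ l : List V, l.Nodup → l.IsChain G.Adj → x ∉ l → (∀ v, G.Adj x v → v ∈ l) →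
      (∀ v ∈ l.head?, G.Adj x v) → (∀ v ∈ l.getLast?, G.Adj v x) → G.degree x < c := by
    intro l hnd hch hxl hl hhead hlast
    have hlen : G.degree x ≤ l.length := by
      rw [← card_neighborFinset_eq_degree, ← List.toFinset_card_of_nodup hnd]
      exact Finset.card_le_card fun v hv => List.mem_toFinset.2 (hl v ((hmem v).1 hv))
    have := hmax x l (List.nodup_cons.2 ⟨hxl, hnd⟩) ?_ (by omega)
    · omega
    · refine List.isChain_cons.2 ⟨fun v hv => ?_, List.isChain_append.2 ⟨hch, by simp, ?_⟩⟩
      · cases l with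
        | nil => simp at hlen; omega
        | cons a l => exact hhead v (by simpa using hv)
      · intro v hv w hw
        obtain rfl : x = w := by simpa using hw
        exact hlast v hv
  rcases exists_hamiltonian_list_or_cliques (G := G) (G.neighborFinset x)
    (fun a ha b hb c hc => hfree x a b c ((hmem a).1 ha) ((hmem b).1 hb) ((hmem c).1 hc))
    with ⟨l, hnd, hch, hl⟩ | ⟨K, M, hK, hM, hKM, hdisj, hKc, hMc⟩
  · simp only [hmem] at hl
    exact key l hnd hch (fun h => G.irrefl ((hl x).1 h)) (fun v hv => (hl v).2 hv)
      (fun v hv => (hl v).1 (List.mem_of_head? hv))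
      (fun v hv => ((hl v).1 (List.mem_of_getLast? hv)).symm)
  simp only [hmem] at hKM
  have hxK : x ∉ K := fun h => G.irrefl ((hKM x).2 (.inl h))
  have hxM : x ∉ M := fun h => G.irrefl ((hKM x).2 (.inr h))
  obtain ⟨a, b, m, ha, hb, hmch, hmnd, hxm, hm⟩ := hG.exists_isChain (x := x)
    (S := {v | v ∈ K}) (T := {v | v ∈ M}) (fun v hv hv' => (hdisj v hv v hv').1 rfl) hxK hxM hK hM
  have hmK : ∀ v ∈ m, v ∉ K := fun v hv => (hm v hv).1
  have hmM : ∀ v ∈ m, v ∉ M := fun v hv => (hm v hv).2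
  obtain ⟨la, hland, hlach, hla⟩ := exists_list_of_clique hKc (a := a) ha
  obtain ⟨lb, hlbnd, hlbch, hlb⟩ := exists_list_of_clique hMc (a := b) hb
  refine key ((a :: la).reverse ++ (m ++ b :: lb)) ?_ ?_ ?_ ?_ ?_ ?_
  · refine List.nodup_append.2 ⟨List.nodup_reverse.2 hland,
      List.nodup_append.2 ⟨hmnd, hlbnd, ?_⟩, ?_⟩
    · rintro v hv v' hv' rfl
      exact hmM v hv ((hlb v).1 hv')
    · rintro v hv v' hv' rfl
      have hvK := (hla v).1 (List.mem_reverse.1 hv)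
      rcases List.mem_append.1 hv' with h | h
      · exact hmK v h hvK
      · exact (hdisj v hvK v ((hlb v).1 h)).1 rfl
  · have h₃ : (a :: la).reverse ++ (m ++ b :: lb) = la.reverse ++ a :: (m ++ b :: lb) := by simp
    rw [h₃, List.isChain_split, ← List.cons_append]
    exact ⟨by rw [← isChain_adj_reverse]; simpa using hlach, List.isChain_split.2 ⟨hmch, hlbch⟩⟩
  · rw [List.mem_append, List.mem_append, List.mem_reverse, hla, hlb]
    tauto
  · intro v hv
    rw [List.mem_append, List.mem_append, List.mem_reverse, hla, hlb]
    have := (hKM v).1 hv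
    tauto
  · intro v hv
    rw [List.head?_append_of_ne_nil _ (by simp)] at hv
    exact (hKM v).2 (.inl ((hla v).1 (List.mem_reverse.1 (List.mem_of_head? hv))))
  · intro v hv
    rw [← List.append_assoc, List.getLast?_append_of_ne_nil _ (by simp)] at hv
    exact ((hKM v).2 (.inr ((hlb v).1 (List.mem_of_getLast? hv)))).symm

end Detours

end SimpleGraph

theorem stmt_8 {V : Type*} [Fintype V] [DecidableEq V] (G : SimpleGraph V)
    [DecidableRel G.Adj] (hG : TwoConnected G)
    (hfree : ¬ ∃ (c : V) (l : Fin 3 → V), Function.Injective l ∧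
      (∀ i, G.Adj c (l i)) ∧ (∀ i j, i ≠ j → ¬ G.Adj (l i) (l j)))
    (a : V) (C : G.Walk a a) (hC : C.IsCycle)
    (hlong : ∀ (b : V) (C' : G.Walk b b), C'.IsCycle → C'.length ≤ C.length) :
    ∀ v : V, Fintype.card V ≤ 2 * G.degree v → v ∈ C.support := by
  classical
  intro x hdeg
  by_contra hxC
  have hclaw : ∀ x a b c, G.Adj x a → G.Adj x b → G.Adj x c → a ≠ b → a ≠ c → b ≠ c →
      G.Adj a b ∨ G.Adj a c ∨ G.Adj b c := by
    intro x a b c ha hb hc hab hac hbc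
    by_contra! h
    refine hfree ⟨x, ![a, b, c], ?_, ?_, ?_⟩
    · intro i j hij
      fin_cases i <;> fin_cases j <;> simp_all
    · intro i
      fin_cases i <;> simp_all
    · intro i j hij
      fin_cases i <;> fin_cases j <;> simp_all [G.adj_comm]
  have hmax : ∀ (a : V) (l : List V), (a :: l).Nodup → (a :: l ++ [a]).IsChain G.Adj →
      2 ≤ l.length → l.length + 1 ≤ C.length := by
    intro a l hnd hch hl
    obtain ⟨b, C', hC', hlen⟩ := exists_isCycle_of_isChain hnd hch hl
    exact hlen ▸ hlong b C' hC'
  have hf := hC.isCyclicEnum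
  set f : ℕ → V := fun i => C.getVert (i % C.length)
  have hx : x ∉ Set.range f := by
    rintro ⟨i, rfl⟩
    exact hxC (C.getVert_mem_support _)
  have h3 := hG.1
  have hlt := degree_lt_of_claw_free hG hclaw hmax (x := x) (by omega)
  have hcard := hf.card_add_card_lt hx
  have hsum := card_neighborFinset_filter (G := G) (x := x) (Set.range f)
  obtain ⟨u₁, hu₁, u₂, hu₂, hne⟩ := Finset.one_lt_card.1
    (show 1 < ((G.neighborFinset x).filter (· ∈ Set.range f)).card by omega)
  simp only [Finset.mem_filter, mem_neighborFinset] at hu₁ hu₂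
  have := hf.degree_lt_of_hasDetours hC.three_le_length hmax hx
    (hasDetours_of_claw_free hG hclaw hx hu₁.2 hu₂.2 hu₁.1 hu₂.1 hne)
  omega
end

section
/- Let G be a 2-connected graph on n vertices such that for every pair of vertices u, v at distance 2 in G, max{d(u), d(v)} >= n/2. Then G is Hamiltonian. -/
open SimpleGraph

namespace SimpleGraph

variable {V : Type*} {G H : SimpleGraph V}

section Closure

variable [Fintype V] [DecidableEq V]

/-- A list enumerating all vertices, with cyclically consecutive entries adjacent, gives a
Hamiltonian cycle. -/
theorem isHamiltonian_of_list (h3 : 3 ≤ Fintype.card V) {l : List V} (hl : l.Nodup)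
    (hmem : ∀ v, v ∈ l) (hne : l ≠ []) (hchain : l.IsChain G.Adj)
    (hadj : G.Adj (l.getLast hne) (l.head hne)) : G.IsHamiltonian := by
  intro _
  have hsupp := Walk.support_ofSupport hne hchain
  have hlen : l.length = Fintype.card V := by
    rw [← List.toFinset_card_of_nodup hl, ← Finset.card_univ]
    congr 1
    ext v
    simp [hmem]
  set q := Walk.ofSupport l hne hchain with hq
  have hqp : q.IsPath := by rw [Walk.isPath_def, hsupp]; exact hl
  have hqlen : q.length + 1 = Fintype.card V := by
    rw [← Walk.length_support, hsupp, hlen]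
  refine ⟨_, Walk.cons hadj q, ?_⟩
  rw [Walk.isHamiltonianCycle_iff_isCycle_and_length_eq]
  refine ⟨(Walk.cons_isCycle_iff _ _).2 ⟨hqp, fun he ↦ ?_⟩, by simpa using hqlen⟩
  have h1 := hqp.eq_snd_of_mem_edges (Sym2.eq_swap ▸ he)
  have h2 : (1 : ℕ) = q.length := by
    apply hqp.getVert_injOn (by simp; omega) (by simp)
    rw [Walk.getVert_length]
    exact h1.symm
  omega

/-- Ore's crossover: a Hamiltonian path whose ends have large degree sum yields a
Hamiltonian cycle. -/
theorem Walk.IsHamiltonian.graph_isHamiltonian_of_degree [DecidableRel G.Adj]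
    (h3 : 3 ≤ Fintype.card V) {u v : V} {q : G.Walk u v} (hq : q.IsHamiltonian)
    (hdeg : Fintype.card V ≤ G.degree u + G.degree v) : G.IsHamiltonian := by
  have hlen := hq.length_eq
  obtain ⟨i, hi, hui, hvi⟩ : ∃ i < q.length,
      G.Adj u (q.getVert (i + 1)) ∧ G.Adj v (q.getVert i) := by
    by_contra! hno
    let A := (Finset.range q.length).filter fun i ↦ G.Adj u (q.getVert (i + 1))
    let B := (Finset.range q.length).filter fun i ↦ G.Adj v (q.getVert i)
    have hA : G.degree u ≤ A.card := by
      rw [← card_neighborFinset_eq_degree]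
      refine (Finset.card_le_card fun w hw ↦ ?_).trans
        (Finset.card_image_le (s := A) (f := fun i ↦ q.getVert (i + 1)))
      rw [mem_neighborFinset] at hw
      obtain ⟨n, rfl, hn⟩ := Walk.mem_support_iff_exists_getVert.1 (hq.mem_support w)
      obtain _ | n := n
      · simp at hw
      · exact Finset.mem_image.2 ⟨n, by simp [A, hw]; omega, rfl⟩
    have hB : G.degree v ≤ B.card := by
      rw [← card_neighborFinset_eq_degree]
      refine (Finset.card_le_card fun w hw ↦ ?_).trans
        (Finset.card_image_le (s := B) (f := fun i ↦ q.getVert i))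
      rw [mem_neighborFinset] at hw
      obtain ⟨n, rfl, hn⟩ := Walk.mem_support_iff_exists_getVert.1 (hq.mem_support w)
      obtain rfl | hn := hn.eq_or_lt
      · simp at hw
      · exact Finset.mem_image.2 ⟨n, by simp [B, hw, hn], rfl⟩
    have hdisj : Disjoint A B := by
      rw [Finset.disjoint_left]
      intro i hiA hiB
      simp only [A, B, Finset.mem_filter, Finset.mem_range] at hiA hiB
      exact hno i hiA.1 hiA.2 hiB.2
    have := Finset.card_union_of_disjoint hdisj
    have hsub : (A ∪ B).card ≤ q.length := by
      conv_rhs => rw [← Finset.card_range q.length]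
      exact Finset.card_le_card
        (Finset.union_subset (Finset.filter_subset _ _) (Finset.filter_subset _ _))
    omega
  have hsl : q.support.length = q.length + 1 := q.length_support
  set l₁ := q.support.take (i + 1) with hl₁
  set l₂ := q.support.drop (i + 1) with hl₂
  have happ : l₁ ++ l₂ = q.support := List.take_append_drop _ _
  have hne₁ : l₁ ≠ [] := by
    apply List.ne_nil_of_length_pos; simp [hl₁]
  have hne₂ : l₂ ≠ [] := by
    apply List.ne_nil_of_length_pos; simp [hl₂]; omega
  have hperm : (l₁ ++ l₂.reverse).Perm q.support :=
    happ ▸ (List.reverse_perm l₂).append_left l₁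
  have hhead₁ : l₁.head hne₁ = u := by
    rw [← q.head_support]
    exact List.head_take _
  have hlast₁ : l₁.getLast hne₁ = q.getVert i := by
    rw [q.getVert_eq_support_getElem hi.le]
    grind
  have hhead₂ : l₂.head hne₂ = q.getVert (i + 1) := by
    rw [q.getVert_eq_support_getElem hi]
    grind
  have hlast₂ : l₂.getLast hne₂ = v := by
    simp [hl₂]
  refine isHamiltonian_of_list h3 (l := l₁ ++ l₂.reverse)
    (hperm.nodup_iff.2 hq.isPath.support_nodup) (fun w ↦ hperm.mem_iff.2 (hq.mem_support w)) (by simp [hne₁]) ?_ ?_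
  · rw [List.isChain_append]
    refine ⟨q.isChain_adj_support.take _, ?_, ?_⟩
    · rw [List.isChain_reverse]
      exact (q.isChain_adj_support.drop _).imp fun _ _ h ↦ h.symm
    · rw [List.head?_reverse, List.getLast?_eq_getLast_of_ne_nil hne₁,
        List.getLast?_eq_getLast_of_ne_nil hne₂, hlast₁, hlast₂]
      simpa using hvi.symm
  · rw [List.getLast_append_of_ne_nil _ (by simpa using hne₂), List.getLast_reverse,
      List.head_append_of_ne_nil hne₁, hhead₁, hhead₂]
    exact hui.symm

/-- Bondy–Chvátal: deleting an edge whose ends have large degree sum in the remaining graph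
preserves Hamiltonicity. -/
theorem IsHamiltonian.deleteEdges_of_degree (h3 : 3 ≤ Fintype.card V) (hH : H.IsHamiltonian)
    {u v : V} (huv : u ≠ v) [DecidableRel (H.deleteEdges {s(u, v)}).Adj]
    (hdeg : Fintype.card V ≤
      (H.deleteEdges {s(u, v)}).degree u + (H.deleteEdges {s(u, v)}).degree v) :
    (H.deleteEdges {s(u, v)}).IsHamiltonian := by
  have : Nontrivial V := ⟨u, v, huv⟩
  obtain ⟨p, hp⟩ := hH.exists_isHamiltonianCycle u
  have key (p : H.Walk u u) (hp : p.IsHamiltonianCycle) (hs : p.snd = v) :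
      (H.deleteEdges {s(u, v)}).IsHamiltonian := by
    cases p with
    | nil => exact absurd rfl hp.ne_nil
    | cons h q =>
      rw [Walk.snd_cons] at hs
      subst hs
      have hc := (Walk.cons_isCycle_iff _ _).1 hp.isCycle
      have hlen := hp.length_eq
      rw [Walk.length_cons] at hlen
      have he : ∀ e ∈ q.edges, e ∈ (H.deleteEdges {s(u, _)}).edgeSet := fun e he ↦ by
        rw [edgeSet_deleteEdges]
        exact ⟨q.edges_subset_edgeSet he, fun h' ↦ hc.2 (h' ▸ he)⟩
      refine (Walk.isHamiltonian_iff_isPath_and_length_eq.2 ⟨hc.1.transfer he, ?_⟩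
        |>.graph_isHamiltonian_of_degree h3 (by omega))
      rw [Walk.length_transfer]
      omega
  by_cases hmem : s(u, v) ∈ p.edges
  · by_cases hs : p.snd = v
    · exact key p hp hs
    · refine key p.reverse ?_ ?_
      · rw [Walk.isHamiltonianCycle_iff_isCycle_and_length_eq] at hp ⊢
        simpa using hp
      · cases p with
        | nil => exact absurd rfl hp.ne_nil
        | cons h q =>
          rw [Walk.snd_cons] at hs
          have hc := (Walk.cons_isCycle_iff _ _).1 hp.isCycle
          rw [Walk.edges_cons, List.mem_cons] at hmem
          have hmem : s(u, v) ∈ q.edges := by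
            refine hmem.resolve_left fun h' ↦ hs ?_
            simpa [huv] using h'.symm
          have := hc.1.eq_penultimate_of_mem_edges (w := v) (Sym2.eq_swap ▸ hmem)
          rw [Walk.snd_reverse, Walk.penultimate_cons_of_not_nil, this]
          intro hnil
          simp [Walk.edges_eq_nil.2 hnil] at hmem
  · intro _
    refine ⟨u, p.transfer _ fun e he ↦ ?_, ?_⟩
    · rw [edgeSet_deleteEdges]
      exact ⟨p.edges_subset_edgeSet he, fun h' ↦ hmem (h' ▸ he)⟩
    · rw [Walk.isHamiltonianCycle_iff_isCycle_and_length_eq] at hp ⊢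
      exact ⟨hp.1.transfer _, by rw [Walk.length_transfer, hp.2]⟩

/-- If `H` is a Hamiltonian supergraph of `G` all of whose additional edges join vertices with
large degree sum in `G`, then `G` is Hamiltonian. -/
theorem IsHamiltonian.of_le_of_degree [DecidableRel G.Adj] (h3 : 3 ≤ Fintype.card V)
    (hGH : G ≤ H) (hH : H.IsHamiltonian)
    (hdeg : ∀ u v, H.Adj u v → ¬ G.Adj u v → Fintype.card V ≤ G.degree u + G.degree v) :
    G.IsHamiltonian := by
  classical
  obtain ⟨K, hKH, ⟨hGK, hK⟩, hmin⟩ :=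
    exists_minimal_le_of_wellFoundedLT (fun K : SimpleGraph V ↦ G ≤ K ∧ K.IsHamiltonian) H
      ⟨hGH, hH⟩
  by_cases hKG : K ≤ G
  · exact hK.mono hKG
  obtain ⟨u, v, huv, hnuv⟩ : ∃ u v, K.Adj u v ∧ ¬ G.Adj u v := by
    by_contra! h
    exact hKG fun u v ↦ h u v
  have hle : G ≤ K.deleteEdges {s(u, v)} := fun a b hab ↦ by
    rw [deleteEdges_adj]
    refine ⟨hGK hab, fun h ↦ hnuv ?_⟩
    rw [← mem_edgeSet] at hab ⊢
    rwa [← Set.mem_singleton_iff.1 h]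
  have hd (w : V) : G.degree w ≤ (K.deleteEdges {s(u, v)}).degree w := degree_le_of_le hle
  have := hmin ⟨hle, hK.deleteEdges_of_degree h3 huv.ne
    ((hdeg u v (hKH huv) hnuv).trans (add_le_add (hd u) (hd v)))⟩ (deleteEdges_le _) huv
  simp at this

end Closure

/-- In a 2-connected graph, deleting a vertex `c` leaves an edge across every nontrivial
bipartition of the remaining vertices. -/
theorem _root_.TwoConnected.exists_adj_of_mem_of_notMem [Fintype V] (hG : TwoConnected G)
    {c a b : V} {K : Set V} (ha : a ∈ K) (hac : a ≠ c) (hb : b ∉ K) (hbc : b ≠ c) :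
    ∃ x ∈ K, ∃ y ∉ K, x ≠ c ∧ y ≠ c ∧ G.Adj x y := by
  obtain ⟨p⟩ := (hG.2 c).preconnected ⟨a, hac⟩ ⟨b, hbc⟩
  obtain ⟨d, -, h1, h2⟩ := p.exists_boundary_dart {w | (w : V) ∈ K} ha hb
  exact ⟨d.fst, h1, d.snd, h2, d.fst.2, d.snd.2, d.adj⟩

theorem IsClique.isChain_of_nodup {K : Set V} (hK : G.IsClique K) {l : List V} (hl : l.Nodup)
    (hlK : ∀ x ∈ l, x ∈ K) : l.IsChain G.Adj :=
  (hl.imp_of_mem fun ha hb hab ↦ hK (hlK _ ha) (hlK _ hb) hab).isChain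

/-- A finite clique has a Hamiltonian path between any two prescribed ends. -/
theorem IsClique.exists_list [DecidableEq V] {K : Finset V} (hK : G.IsClique (K : Set V))
    {x y : V} (hx : x ∈ K) (hy : y ∈ K) (hxy : x ≠ y ∨ K = {x}) :
    ∃ l : List V, l.Nodup ∧ (∀ z, z ∈ l ↔ z ∈ K) ∧ l.IsChain G.Adj ∧
      l.head? = some x ∧ l.getLast? = some y := by
  by_cases h : x = y
  · subst h
    exact ⟨[x], by simp, by simp [hxy.resolve_left (· rfl)], by simp, rfl, rfl⟩
  · have hnd : (x :: (((K.erase x).erase y).toList ++ [y])).Nodup := by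
      simp [List.nodup_append, Finset.nodup_toList, h]
      tauto
    have hmem : ∀ z, z ∈ x :: (((K.erase x).erase y).toList ++ [y]) ↔ z ∈ K := by
      intro z
      by_cases hzx : z = x
      · simp [hzx, hx]
      · by_cases hzy : z = y <;> simp [hzx, hzy, hy]
    refine ⟨_, hnd, hmem, hK.isChain_of_nodup hnd fun z ↦ (hmem z).1, rfl, ?_⟩
    rw [← List.cons_append, List.getLast?_concat]

variable {B : Set V}

/-- The closed neighbourhood of `v` outside the set `B`. -/
def outerNbhd (G : SimpleGraph V) (B : Set V) (v : V) : Set V :=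
  {x | x ∉ B ∧ (x = v ∨ G.Adj v x)}

/-- The vertices outside `B` behave like the low-degree vertices in Fan's theorem: any two with a
common neighbour are adjacent. -/
def IsFanCore (G : SimpleGraph V) (B : Set V) : Prop :=
  ∀ ⦃x y w : V⦄, x ∉ B → y ∉ B → x ≠ y → G.Adj w x → G.Adj w y → G.Adj x y

theorem IsFanCore.isClique_outerNbhd (hB : G.IsFanCore B) (v : V) :
    G.IsClique (G.outerNbhd B v) := by
  rintro x ⟨hx, rfl | hvx⟩ y ⟨hy, rfl | hvy⟩ hxy
  · exact absurd rfl hxy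
  · exact hvy
  · exact hvx.symm
  · exact hB hx hy hxy hvx hvy

theorem IsFanCore.mem_outerNbhd_of_adj (hB : G.IsFanCore B) {v x y : V} (hv : v ∉ B)
    (hx : x ∈ G.outerNbhd B v) (hy : y ∉ B) (hxy : G.Adj x y) : y ∈ G.outerNbhd B v := by
  refine ⟨hy, ?_⟩
  obtain ⟨-, rfl | hvx⟩ := hx
  · exact Or.inr hxy
  · by_cases h : y = v
    · exact Or.inl h
    · exact Or.inr (hB hv hy (Ne.symm h) hvx.symm hxy)

theorem IsFanCore.mem_outerNbhd_of_adj_of_adj (hB : G.IsFanCore B) {v x y w : V} (hv : v ∉ B)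
    (hx : x ∈ G.outerNbhd B v) (hy : y ∉ B) (hwx : G.Adj w x) (hwy : G.Adj w y) :
    y ∈ G.outerNbhd B v := by
  by_cases h : x = y
  · exact h ▸ hx
  · exact hB.mem_outerNbhd_of_adj hv hx hy (hB hx.1 hy h hwx hwy)

/-- A list of distinct vertices that traces a path of `H`, starts and ends in `B`, and contains
every outer `G`-neighbour of its members. -/
structure IsCoreSegment (G H : SimpleGraph V) (B : Set V) (l : List V) : Prop where
  nodup : l.Nodup
  isChain : l.IsChain H.Adj
  head_mem : ∀ a ∈ l.head?, a ∈ B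
  getLast_mem : ∀ a ∈ l.getLast?, a ∈ B
  closed : ∀ x ∈ l, ∀ y ∉ B, G.Adj x y → y ∈ l

theorem IsCoreSegment.append (hH : H.IsClique B) {l₁ l₂ : List V} (h₁ : IsCoreSegment G H B l₁)
    (h₂ : l₂.Nodup) (hc : l₂.IsChain H.Adj) (hhead : ∀ a ∈ l₂.head?, a ∈ B)
    (hlast : ∀ a ∈ l₂.getLast?, a ∈ B) (hdisj : l₁.Disjoint l₂)
    (hclosed : ∀ x ∈ l₂, ∀ y ∉ B, G.Adj x y → y ∈ l₁ ++ l₂) : IsCoreSegment G H B (l₁ ++ l₂) where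
  nodup := h₁.nodup.append h₂ hdisj
  isChain := List.isChain_append.2 ⟨h₁.isChain, hc, fun a ha b hb ↦
    hH (h₁.getLast_mem a ha) (hhead b hb) fun hab ↦
      hdisj (List.mem_of_getLast? ha) (hab ▸ List.mem_of_mem_head? hb)⟩
  head_mem a ha := by
    rw [List.head?_append] at ha
    cases h : l₁.head? with
    | none => exact hhead a (by simpa [h] using ha)
    | some b => exact h₁.head_mem a (by simpa [h] using ha)
  getLast_mem a ha := by
    rw [List.getLast?_append] at ha
    cases h : l₂.getLast? with
    | none => exact h₁.getLast_mem a (by simpa [h] using ha)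
    | some b => exact hlast a (by simpa [h] using ha)
  closed x hx y hy hxy := by
    obtain hx | hx := List.mem_append.1 hx
    · exact List.mem_append_left _ (h₁.closed x hx y hy hxy)
    · exact hclosed x hx y hy hxy

section Fintype

variable [Fintype V]

/-- Two independent edges (or two edges at a single vertex, when that is everything) leave the
closed outer neighbourhood of a vertex. -/
theorem IsFanCore.exists_exits (hB : G.IsFanCore B) (hG : TwoConnected G)
    (hB2 : ∀ h, ∃ x ∈ B, x ≠ h) {v : V} (hv : v ∉ B) :
    ∃ b ∈ B, ∃ b' ∈ B, ∃ x ∈ G.outerNbhd B v, ∃ y ∈ G.outerNbhd B v, b ≠ b' ∧ G.Adj b x ∧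
      G.Adj y b' ∧ (x ≠ y ∨ G.outerNbhd B v = {x}) := by
  have hvK : v ∈ G.outerNbhd B v := ⟨hv, Or.inl rfl⟩
  have exit (c a : V) (ha : a ∈ G.outerNbhd B v) (hac : a ≠ c) :
      ∃ x ∈ G.outerNbhd B v, ∃ b ∈ B, x ≠ c ∧ b ≠ c ∧ G.Adj x b := by
    obtain ⟨h, hh, hhc⟩ := hB2 c
    obtain ⟨x, hx, y, hy, hxc, hyc, hxy⟩ :=
      hG.exists_adj_of_mem_of_notMem ha hac (fun h' ↦ h'.1 hh) hhc
    exact ⟨x, hx, y, by_contra fun hyB ↦ hy (hB.mem_outerNbhd_of_adj hv hx hyB hxy), hxc, hyc, hxy⟩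
  obtain ⟨h, hh, -⟩ := hB2 v
  obtain ⟨x₁, hx₁, b₁, hb₁, -, -, h₁⟩ := exit h v hvK fun e ↦ hv (e ▸ hh)
  obtain ⟨x₂, hx₂, b₂, hb₂, -, hb, h₂⟩ := exit b₁ v hvK fun e ↦ hv (e ▸ hb₁)
  by_cases hx : x₁ = x₂ ∧ G.outerNbhd B v ≠ {x₁}
  · obtain ⟨rfl, hne⟩ := hx
    obtain ⟨z, hz, hzx⟩ : ∃ z ∈ G.outerNbhd B v, z ≠ x₁ := by
      by_contra! hall
      exact hne (Set.eq_singleton_iff_unique_mem.2 ⟨hx₁, hall⟩)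
    obtain ⟨x₃, hx₃, b₃, hb₃, hx, -, h₃⟩ := exit x₁ z hz hzx
    by_cases hb' : b₃ = b₁
    · exact ⟨b₃, hb₃, b₂, hb₂, x₃, hx₃, x₁, hx₁, by rw [hb']; exact hb.symm, h₃.symm, h₂,
        Or.inl hx⟩
    · exact ⟨b₃, hb₃, b₁, hb₁, x₃, hx₃, x₁, hx₁, hb', h₃.symm, h₁, Or.inl hx⟩
  · exact ⟨b₁, hb₁, b₂, hb₂, x₁, hx₁, x₂, hx₂, hb.symm, h₁.symm, h₂, by tauto⟩

theorem IsFanCore.exists_isCoreSegment_append (hB : G.IsFanCore B) (hG : TwoConnected G)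
    (hB2 : ∀ h, ∃ x ∈ B, x ≠ h) (hGH : G ≤ H) (hH : H.IsClique B) {l : List V}
    (hl : IsCoreSegment G H B l) {v : V} (hvl : v ∉ l) :
    ∃ l' ≠ [], IsCoreSegment G H B (l ++ l') := by
  classical
  by_cases hout : ∃ w, w ∉ B ∧ w ∉ l
  · obtain ⟨w, hw, hwl⟩ := hout
    obtain ⟨b, hb, b', hb', x, hx, y, hy, hbb, hbx, hyb, hxy⟩ := hB.exists_exits hG hB2 hw
    set K := (G.outerNbhd B w).toFinset
    have hKmem (z : V) : z ∈ K ↔ z ∈ G.outerNbhd B w := Set.mem_toFinset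
    obtain ⟨p, hpnd, hpmem, hpc, hph, hpl⟩ := IsClique.exists_list (G := G) (K := K)
      (by simpa [K] using hB.isClique_outerNbhd w) ((hKmem x).2 hx) ((hKmem y).2 hy)
      (hxy.imp_right fun h ↦ by ext z; simp [hKmem, h])
    replace hpmem (z : V) : z ∈ p ↔ z ∈ G.outerNbhd B w := (hpmem z).trans (hKmem z)
    have hKl : ∀ z ∈ G.outerNbhd B w, z ∉ l := by
      rintro z ⟨hz, rfl | hwz⟩ hzl
      · exact hwl hzl
      · exact hwl (hl.closed z hzl w hw hwz.symm)
    have hbp : b ∉ p := fun h ↦ ((hpmem b).1 h).1 hb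
    have hbp' : b' ∉ p := fun h ↦ ((hpmem b').1 h).1 hb'
    refine ⟨b :: (p ++ [b']), by simp, hl.append hH ?_ ?_ ?_ ?_ ?_ ?_⟩
    · rw [List.nodup_cons, List.nodup_append]
      refine ⟨by simp [hbp, hbb], hpnd, by simp, fun a ha c hc ↦ ?_⟩
      rintro rfl
      exact hbp' (List.mem_singleton.1 hc ▸ ha)
    · rw [List.isChain_cons, List.isChain_append]
      refine ⟨?_, hpc.imp fun _ _ h ↦ hGH h, by simp, ?_⟩
      · intro z hz
        rw [List.head?_append, hph] at hz
        obtain rfl : x = z := by simpa using hz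
        exact hGH hbx
      · rw [hpl]
        simpa using hGH hyb
    · simpa using hb
    · rw [← List.cons_append, List.getLast?_concat]
      simpa using hb'
    · intro z hzl hz
      simp only [List.mem_cons, List.mem_append, List.not_mem_nil, or_false] at hz
      obtain rfl | hz | rfl := hz
      · exact hKl x hx (hl.closed _ hzl x hx.1 hbx)
      · exact hKl z ((hpmem z).1 hz) hzl
      · exact hKl y hy (hl.closed _ hzl y hy.1 hyb.symm)
    · intro z hz u hu hzu
      suffices u ∈ G.outerNbhd B w by simp [hpmem, this]
      simp only [List.mem_cons, List.mem_append, List.not_mem_nil, or_false] at hz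
      obtain rfl | hz | rfl := hz
      · exact hB.mem_outerNbhd_of_adj_of_adj hw hx hu hbx hzu
      · exact hB.mem_outerNbhd_of_adj hw ((hpmem z).1 hz) hu hzu
      · exact hB.mem_outerNbhd_of_adj_of_adj hw hy hu hyb.symm hzu
  · push Not at hout
    have hv : v ∈ B := by_contra fun h ↦ hvl (hout v h)
    exact ⟨[v], by simp, hl.append hH (by simp) (by simp) (by simpa) (by simpa) (by simpa)
      fun x _ y hy _ ↦ List.mem_append_left _ (hout y hy)⟩

variable [DecidableEq V]

theorem IsFanCore.isHamiltonian_of_isClique (hB : G.IsFanCore B) (hG : TwoConnected G)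
    (hB2 : ∀ h, ∃ x ∈ B, x ≠ h) (hGH : G ≤ H) (hH : H.IsClique B) : H.IsHamiltonian := by
  obtain ⟨l, hl, hmax⟩ : ∃ l, IsCoreSegment G H B l ∧
      ∀ l', IsCoreSegment G H B l' → l'.length ≤ l.length := by
    let S : Set ℕ := {n | ∃ l, IsCoreSegment G H B l ∧ l.length = n}
    have hS : BddAbove S := ⟨Fintype.card V, by
      rintro _ ⟨l, hl, rfl⟩
      exact hl.nodup.length_le_card⟩
    obtain ⟨l, hl, hlen⟩ := Nat.sSup_mem (s := S) ⟨0, [], ⟨by simp, by simp, by simp, by simp,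
      by simp⟩, rfl⟩ hS
    exact ⟨l, hl, fun l' hl' ↦ hlen ▸ le_csSup hS ⟨l', hl', rfl⟩⟩
  have hmem (v : V) : v ∈ l := by
    by_contra hv
    obtain ⟨l', hne, hl'⟩ := hB.exists_isCoreSegment_append hG hB2 hGH hH hl hv
    have := hmax _ hl'
    have := List.length_pos_iff.2 hne
    rw [List.length_append] at *
    omega
  have hlen : Fintype.card V ≤ l.length := by
    rw [← Finset.card_univ]
    exact (Finset.card_le_card fun v _ ↦ List.mem_toFinset.2 (hmem v)).trans
      (List.toFinset_card_le l)
  have h3 := hG.1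
  have hne : l ≠ [] := List.ne_nil_of_length_pos (by omega)
  refine isHamiltonian_of_list h3 hl.nodup hmem hne hl.isChain
    (hH (hl.getLast_mem _ (List.getLast?_eq_getLast_of_ne_nil hne))
      (hl.head_mem _ (List.head?_eq_some_head hne)) fun heq ↦ ?_)
  rw [List.getLast_eq_getElem, List.head_eq_getElem, hl.nodup.getElem_inj_iff] at heq
  omega

theorem IsFanCore.isHamiltonian_of_subset_singleton (hB : G.IsFanCore B) (hG : TwoConnected G)
    {h : V} (hBh : ∀ x ∈ B, x = h) : G.IsHamiltonian := by
  classical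
  have h3 := hG.1
  have hcl : G.IsClique {x | x ≠ h} := by
    intro x hx y hy hxy
    by_contra hadj
    have hxB : x ∉ B := fun hx' ↦ hx (hBh x hx')
    have hyK : y ∉ G.outerNbhd B x := by rintro ⟨-, rfl | h'⟩ <;> contradiction
    obtain ⟨a, ha, b, hb, -, hbh, hab⟩ :=
      hG.exists_adj_of_mem_of_notMem (K := G.outerNbhd B x) ⟨hxB, Or.inl rfl⟩ hx hyK hy
    exact hb (hB.mem_outerNbhd_of_adj hxB ha (fun hb' ↦ hbh (hBh b hb')) hab)
  have exit (c : V) (hc : c ≠ h) : ∃ x, x ≠ c ∧ G.Adj h x := by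
    obtain ⟨d, hd⟩ : ∃ d, d ∉ ({h, c} : Finset V) := by
      by_contra! hall
      have := Finset.card_le_card fun v (_ : v ∈ Finset.univ) ↦ hall v
      have := Finset.card_le_two (a := h) (b := c)
      rw [Finset.card_univ] at *
      omega
    rw [Finset.mem_insert, Finset.mem_singleton, not_or] at hd
    obtain ⟨x, rfl, y, -, -, hyc, hxy⟩ := hG.exists_adj_of_mem_of_notMem (K := {h}) rfl
      hc.symm hd.1 hd.2
    exact ⟨y, hyc, hxy⟩
  have : Nontrivial V := Fintype.one_lt_card_iff_nontrivial.1 (by omega)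
  obtain ⟨c, hc⟩ := exists_ne h
  obtain ⟨x, -, hx⟩ := exit c hc
  obtain ⟨y, hyx, hy⟩ := exit x hx.ne'
  obtain ⟨l, hnd, hmem, hchain, hhead, hlast⟩ := IsClique.exists_list (G := G)
    (K := Finset.univ.erase h) (hcl.subset fun z hz ↦ by simpa using hz) (x := x) (y := y)
    (by simp [hx.ne']) (by simp [hy.ne']) (Or.inl hyx.symm)
  refine isHamiltonian_of_list h3 (l := h :: l) ?_ ?_ (by simp) ?_ ?_
  · simp [hnd, hmem]
  · intro v
    by_cases hv : v = h <;> simp [hmem, hv]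
  · rw [List.isChain_cons, hhead]
    simpa using ⟨hx, hchain⟩
  · have hne : l ≠ [] := by rintro rfl; simp at hhead
    rw [List.getLast_cons hne, List.head_cons]
    rw [List.getLast?_eq_getLast_of_ne_nil hne, Option.some_inj] at hlast
    rw [hlast]
    exact hy.symm

end Fintype

theorem isFanCore_of_dist [Fintype V] [DecidableRel G.Adj]
    (hfan : ∀ u v : V, G.dist u v = 2 →
      Fintype.card V ≤ 2 * max (G.degree u) (G.degree v)) :
    G.IsFanCore {v | Fintype.card V ≤ 2 * G.degree v} := by
  intro x y w hx hy hxy hwx hwy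
  by_contra hadj
  have h2 : G.dist x y = 2 := by
    rw [dist, edist_eq_two_iff.2 ⟨hxy, hadj, w, hwx.symm, hwy.symm⟩]
    rfl
  have := hfan x y h2
  rw [Set.mem_ofPred_eq] at hx hy
  omega

end SimpleGraph

theorem stmt_15 {V : Type*} [Fintype V] [DecidableEq V] (G : SimpleGraph V)
    [DecidableRel G.Adj] (hG : TwoConnected G)
    (hfan : ∀ u v : V, G.dist u v = 2 →
      Fintype.card V ≤ 2 * max (G.degree u) (G.degree v)) :
    G.IsHamiltonian := by
  set B : Set V := {v | Fintype.card V ≤ 2 * G.degree v}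
  have hB : G.IsFanCore B := isFanCore_of_dist hfan
  by_cases hB2 : ∀ h, ∃ x ∈ B, x ≠ h
  · let H : SimpleGraph V := G ⊔ SimpleGraph.fromRel fun a b ↦ a ∈ B ∧ b ∈ B
    have hH : H.IsClique B := fun a ha b hb hab ↦ Or.inr ⟨hab, Or.inl ⟨ha, hb⟩⟩
    refine (hB.isHamiltonian_of_isClique hG hB2 le_sup_left hH).of_le_of_degree hG.1
      le_sup_left fun u v huv hn ↦ ?_
    obtain ⟨-, ⟨hu, hv⟩ | ⟨hv, hu⟩⟩ := huv.resolve_left hn <;>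
    · rw [Set.mem_ofPred_eq] at hu hv
      omega
  · push Not at hB2
    obtain ⟨h, hh⟩ := hB2
    exact hB.isHamiltonian_of_subset_singleton hG hh
end
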